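/- For any family E of (011→2D)-PI kernels of size n2×(p0,p1) and any family B of 011-PI kernels of size (p0,p1)×(m0,m1), there exists a family T of (011→2D)-PI kernels of size n2×(m0,m1) such that for every triple (v, u1, u2) with v ∈ ℝ^{m0} and continuous u1 : [a,b] → ℝ^{m1}, u2 : [c,d] → ℝ^{m1}, and every (x,y) ∈ [a,b]×[c,d], (P[E](P[B](v,u1,u2)))(x,y) = (P[T](v,u1,u2))(x,y). -/

import Mathlib

open Matrix MeasureTheory Set

noncomputable section

/-- A family of 1D-PI kernels of size `p × r` (the parameters of a 1D-PI operator). -/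
structure PI1DK (p r : ℕ) where
  k0 : ℝ → Matrix (Fin p) (Fin r) ℝ
  k1 : ℝ → ℝ → Matrix (Fin p) (Fin r) ℝ
  k2 : ℝ → ℝ → Matrix (Fin p) (Fin r) ℝ

/-- Continuity of a family of 1D-PI kernels on the interval `[s,t]`. -/
def PI1DK.IsCont {p r : ℕ} (s t : ℝ) (N : PI1DK p r) : Prop :=
  ContinuousOn N.k0 (Icc s t) ∧
  ContinuousOn (fun q : ℝ × ℝ => N.k1 q.1 q.2) (Icc s t ×ˢ Icc s t) ∧
  ContinuousOn (fun q : ℝ × ℝ => N.k2 q.1 q.2) (Icc s t ×ˢ Icc s t)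

/-- The 1D-PI operator on `[s,t]` associated with the kernels `N`. -/
def PI1D {p r : ℕ} (s t : ℝ) (N : PI1DK p r) (u : ℝ → Fin r → ℝ) (x : ℝ) :
    Fin p → ℝ :=
  N.k0 x *ᵥ u x + (∫ θ in s..x, N.k1 x θ *ᵥ u θ) + (∫ θ in x..t, N.k2 x θ *ᵥ u θ)

/-- Entrywise interval integral of a matrix-valued function. -/
def mInt {p r : ℕ} (s t : ℝ) (F : ℝ → Matrix (Fin p) (Fin r) ℝ) :
    Matrix (Fin p) (Fin r) ℝ :=
  Matrix.of fun i j => ∫ η in s..t, F η i j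

/-- A family of 2D-PI kernels of size `p × r`. -/
structure PI2DK (p r : ℕ) where
  k00 : ℝ → ℝ → Matrix (Fin p) (Fin r) ℝ
  k10 : ℝ → ℝ → ℝ → Matrix (Fin p) (Fin r) ℝ
  k20 : ℝ → ℝ → ℝ → Matrix (Fin p) (Fin r) ℝ
  k01 : ℝ → ℝ → ℝ → Matrix (Fin p) (Fin r) ℝ
  k02 : ℝ → ℝ → ℝ → Matrix (Fin p) (Fin r) ℝ
  k11 : ℝ → ℝ → ℝ → ℝ → Matrix (Fin p) (Fin r) ℝ
  k21 : ℝ → ℝ → ℝ → ℝ → Matrix (Fin p) (Fin r) ℝ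
  k12 : ℝ → ℝ → ℝ → ℝ → Matrix (Fin p) (Fin r) ℝ
  k22 : ℝ → ℝ → ℝ → ℝ → Matrix (Fin p) (Fin r) ℝ

/-- Continuity of a family of 2D-PI kernels on `[a,b] × [c,d]`. -/
def PI2DK.IsCont {p r : ℕ} (a b c d : ℝ) (N : PI2DK p r) : Prop :=
  ContinuousOn (fun q : ℝ × ℝ => N.k00 q.1 q.2) (Icc a b ×ˢ Icc c d) ∧
  ContinuousOn (fun q : ℝ × ℝ × ℝ => N.k10 q.1 q.2.1 q.2.2)
    (Icc a b ×ˢ Icc c d ×ˢ Icc a b) ∧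
  ContinuousOn (fun q : ℝ × ℝ × ℝ => N.k20 q.1 q.2.1 q.2.2)
    (Icc a b ×ˢ Icc c d ×ˢ Icc a b) ∧
  ContinuousOn (fun q : ℝ × ℝ × ℝ => N.k01 q.1 q.2.1 q.2.2)
    (Icc a b ×ˢ Icc c d ×ˢ Icc c d) ∧
  ContinuousOn (fun q : ℝ × ℝ × ℝ => N.k02 q.1 q.2.1 q.2.2)
    (Icc a b ×ˢ Icc c d ×ˢ Icc c d) ∧
  ContinuousOn (fun q : ℝ × ℝ × ℝ × ℝ => N.k11 q.1 q.2.1 q.2.2.1 q.2.2.2)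
    (Icc a b ×ˢ Icc c d ×ˢ Icc a b ×ˢ Icc c d) ∧
  ContinuousOn (fun q : ℝ × ℝ × ℝ × ℝ => N.k21 q.1 q.2.1 q.2.2.1 q.2.2.2)
    (Icc a b ×ˢ Icc c d ×ˢ Icc a b ×ˢ Icc c d) ∧
  ContinuousOn (fun q : ℝ × ℝ × ℝ × ℝ => N.k12 q.1 q.2.1 q.2.2.1 q.2.2.2)
    (Icc a b ×ˢ Icc c d ×ˢ Icc a b ×ˢ Icc c d) ∧
  ContinuousOn (fun q : ℝ × ℝ × ℝ × ℝ => N.k22 q.1 q.2.1 q.2.2.1 q.2.2.2)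
    (Icc a b ×ˢ Icc c d ×ˢ Icc a b ×ˢ Icc c d)

/-- The 2D-PI operator on `[a,b] × [c,d]` associated with the kernels `N`. -/
def PI2D {p r : ℕ} (a b c d : ℝ) (N : PI2DK p r) (u : ℝ → ℝ → Fin r → ℝ)
    (x y : ℝ) : Fin p → ℝ :=
  N.k00 x y *ᵥ u x y
  + (∫ θ in a..x, N.k10 x y θ *ᵥ u θ y)
  + (∫ θ in x..b, N.k20 x y θ *ᵥ u θ y)
  + (∫ ν in c..y, N.k01 x y ν *ᵥ u x ν)
  + (∫ ν in y..d, N.k02 x y ν *ᵥ u x ν)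
  + (∫ θ in a..x, ∫ ν in c..y, N.k11 x y θ ν *ᵥ u θ ν)
  + (∫ θ in x..b, ∫ ν in c..y, N.k21 x y θ ν *ᵥ u θ ν)
  + (∫ θ in a..x, ∫ ν in y..d, N.k12 x y θ ν *ᵥ u θ ν)
  + (∫ θ in x..b, ∫ ν in y..d, N.k22 x y θ ν *ᵥ u θ ν)

/-- A family of 011-PI kernels of size `(p0,p1) × (r0,r1)`. -/
structure PI011K (p0 p1 r0 r1 : ℕ) where
  b00 : Matrix (Fin p0) (Fin r0) ℝ
  b01 : ℝ → Matrix (Fin p0) (Fin r1) ℝ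
  b02 : ℝ → Matrix (Fin p0) (Fin r1) ℝ
  b10 : ℝ → Matrix (Fin p1) (Fin r0) ℝ
  b20 : ℝ → Matrix (Fin p1) (Fin r0) ℝ
  b12 : ℝ → ℝ → Matrix (Fin p1) (Fin r1) ℝ
  b21 : ℝ → ℝ → Matrix (Fin p1) (Fin r1) ℝ
  b11 : PI1DK p1 r1
  b22 : PI1DK p1 r1

/-- Continuity of a family of 011-PI kernels. -/
def PI011K.IsCont {p0 p1 r0 r1 : ℕ} (a b c d : ℝ) (B : PI011K p0 p1 r0 r1) : Prop :=
  ContinuousOn B.b01 (Icc a b) ∧ ContinuousOn B.b02 (Icc c d) ∧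
  ContinuousOn B.b10 (Icc a b) ∧ ContinuousOn B.b20 (Icc c d) ∧
  ContinuousOn (fun q : ℝ × ℝ => B.b12 q.1 q.2) (Icc a b ×ˢ Icc c d) ∧
  ContinuousOn (fun q : ℝ × ℝ => B.b21 q.1 q.2) (Icc c d ×ˢ Icc a b) ∧
  B.b11.IsCont a b ∧ B.b22.IsCont c d

/-- The 011-PI operator associated with the kernels `B`. -/
def PI011 {p0 p1 r0 r1 : ℕ} (a b c d : ℝ) (B : PI011K p0 p1 r0 r1)
    (v : Fin r0 → ℝ) (u1 u2 : ℝ → Fin r1 → ℝ) :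
    (Fin p0 → ℝ) × (ℝ → Fin p1 → ℝ) × (ℝ → Fin p1 → ℝ) :=
  ( B.b00 *ᵥ v + (∫ θ in a..b, B.b01 θ *ᵥ u1 θ) + (∫ ν in c..d, B.b02 ν *ᵥ u2 ν),
    fun x => B.b10 x *ᵥ v + PI1D a b B.b11 u1 x + (∫ ν in c..d, B.b12 x ν *ᵥ u2 ν),
    fun y => B.b20 y *ᵥ v + (∫ θ in a..b, B.b21 y θ *ᵥ u1 θ) + PI1D c d B.b22 u2 y )

/-- A family of (2D→011)-PI kernels of size `(p0,p1) × r`. -/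
structure PI2Dto011K (p0 p1 r : ℕ) where
  d0 : ℝ → ℝ → Matrix (Fin p0) (Fin r) ℝ
  d10 : ℝ → ℝ → Matrix (Fin p1) (Fin r) ℝ
  d11 : ℝ → ℝ → ℝ → Matrix (Fin p1) (Fin r) ℝ
  d12 : ℝ → ℝ → ℝ → Matrix (Fin p1) (Fin r) ℝ
  d20 : ℝ → ℝ → Matrix (Fin p1) (Fin r) ℝ
  d21 : ℝ → ℝ → ℝ → Matrix (Fin p1) (Fin r) ℝ
  d22 : ℝ → ℝ → ℝ → Matrix (Fin p1) (Fin r) ℝ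

/-- Continuity of a family of (2D→011)-PI kernels. -/
def PI2Dto011K.IsCont {p0 p1 r : ℕ} (a b c d : ℝ) (D : PI2Dto011K p0 p1 r) : Prop :=
  ContinuousOn (fun q : ℝ × ℝ => D.d0 q.1 q.2) (Icc a b ×ˢ Icc c d) ∧
  ContinuousOn (fun q : ℝ × ℝ => D.d10 q.1 q.2) (Icc a b ×ˢ Icc c d) ∧
  ContinuousOn (fun q : ℝ × ℝ × ℝ => D.d11 q.1 q.2.1 q.2.2)
    (Icc a b ×ˢ Icc c d ×ˢ Icc a b) ∧
  ContinuousOn (fun q : ℝ × ℝ × ℝ => D.d12 q.1 q.2.1 q.2.2)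
    (Icc a b ×ˢ Icc c d ×ˢ Icc a b) ∧
  ContinuousOn (fun q : ℝ × ℝ => D.d20 q.1 q.2) (Icc a b ×ˢ Icc c d) ∧
  ContinuousOn (fun q : ℝ × ℝ × ℝ => D.d21 q.1 q.2.1 q.2.2)
    (Icc a b ×ˢ Icc c d ×ˢ Icc c d) ∧
  ContinuousOn (fun q : ℝ × ℝ × ℝ => D.d22 q.1 q.2.1 q.2.2)
    (Icc a b ×ˢ Icc c d ×ˢ Icc c d)

/-- The (2D→011)-PI operator associated with the kernels `D`. -/
def PI2Dto011 {p0 p1 r : ℕ} (a b c d : ℝ) (D : PI2Dto011K p0 p1 r)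
    (u : ℝ → ℝ → Fin r → ℝ) :
    (Fin p0 → ℝ) × (ℝ → Fin p1 → ℝ) × (ℝ → Fin p1 → ℝ) :=
  ( ∫ θ in a..b, ∫ ν in c..d, D.d0 θ ν *ᵥ u θ ν,
    fun x => ∫ y in c..d,
      (D.d10 x y *ᵥ u x y + (∫ θ in a..x, D.d11 x y θ *ᵥ u θ y)
        + (∫ θ in x..b, D.d12 x y θ *ᵥ u θ y)),
    fun y => ∫ x in a..b,
      (D.d20 x y *ᵥ u x y + (∫ ν in c..y, D.d21 x y ν *ᵥ u x ν)
        + (∫ ν in y..d, D.d22 x y ν *ᵥ u x ν)) )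

/-- A family of (011→2D)-PI kernels of size `p × (r0,r1)`. -/
structure PI011to2DK (p r0 r1 : ℕ) where
  e0 : ℝ → ℝ → Matrix (Fin p) (Fin r0) ℝ
  e10 : ℝ → ℝ → Matrix (Fin p) (Fin r1) ℝ
  e11 : ℝ → ℝ → ℝ → Matrix (Fin p) (Fin r1) ℝ
  e12 : ℝ → ℝ → ℝ → Matrix (Fin p) (Fin r1) ℝ
  e20 : ℝ → ℝ → Matrix (Fin p) (Fin r1) ℝ
  e21 : ℝ → ℝ → ℝ → Matrix (Fin p) (Fin r1) ℝ
  e22 : ℝ → ℝ → ℝ → Matrix (Fin p) (Fin r1) ℝ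

/-- Continuity of a family of (011→2D)-PI kernels. -/
def PI011to2DK.IsCont {p r0 r1 : ℕ} (a b c d : ℝ) (E : PI011to2DK p r0 r1) : Prop :=
  ContinuousOn (fun q : ℝ × ℝ => E.e0 q.1 q.2) (Icc a b ×ˢ Icc c d) ∧
  ContinuousOn (fun q : ℝ × ℝ => E.e10 q.1 q.2) (Icc a b ×ˢ Icc c d) ∧
  ContinuousOn (fun q : ℝ × ℝ × ℝ => E.e11 q.1 q.2.1 q.2.2)
    (Icc a b ×ˢ Icc c d ×ˢ Icc a b) ∧
  ContinuousOn (fun q : ℝ × ℝ × ℝ => E.e12 q.1 q.2.1 q.2.2)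
    (Icc a b ×ˢ Icc c d ×ˢ Icc a b) ∧
  ContinuousOn (fun q : ℝ × ℝ => E.e20 q.1 q.2) (Icc a b ×ˢ Icc c d) ∧
  ContinuousOn (fun q : ℝ × ℝ × ℝ => E.e21 q.1 q.2.1 q.2.2)
    (Icc a b ×ˢ Icc c d ×ˢ Icc c d) ∧
  ContinuousOn (fun q : ℝ × ℝ × ℝ => E.e22 q.1 q.2.1 q.2.2)
    (Icc a b ×ˢ Icc c d ×ˢ Icc c d)

/-- The (011→2D)-PI operator associated with the kernels `E`. -/
def PI011to2D {p r0 r1 : ℕ} (a b c d : ℝ) (E : PI011to2DK p r0 r1)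
    (v : Fin r0 → ℝ) (u1 u2 : ℝ → Fin r1 → ℝ) (x y : ℝ) : Fin p → ℝ :=
  E.e0 x y *ᵥ v + E.e10 x y *ᵥ u1 x
  + (∫ θ in a..x, E.e11 x y θ *ᵥ u1 θ) + (∫ θ in x..b, E.e12 x y θ *ᵥ u1 θ)
  + E.e20 x y *ᵥ u2 y
  + (∫ ν in c..y, E.e21 x y ν *ᵥ u2 ν) + (∫ ν in y..d, E.e22 x y ν *ᵥ u2 ν)


section Integrals

variable {E : Type*} [NormedAddCommGroup E] [NormedSpace ℝ E]

theorem intervalIntegral_add_of_continuous {f g : ℝ → E} {s t : ℝ}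
    (hf : Continuous f) (hg : Continuous g) :
    ∫ θ in s..t, (f θ + g θ) = (∫ θ in s..t, f θ) + ∫ θ in s..t, g θ :=
  intervalIntegral.integral_add (hf.intervalIntegrable _ _) (hg.intervalIntegrable _ _)

theorem intervalIntegral_split_of_continuous {f : ℝ → E} (hf : Continuous f) (s x t : ℝ) :
    ∫ θ in s..t, f θ = (∫ θ in s..x, f θ) + ∫ θ in x..t, f θ :=
  (intervalIntegral.integral_add_adjacent_intervals
    (hf.intervalIntegrable _ _) (hf.intervalIntegrable _ _)).symm

@[fun_prop]
theorem Continuous.intervalIntegral_of_continuous {X : Type*} [TopologicalSpace X]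
    {f : X → ℝ → E} {s t : X → ℝ} (hf : Continuous (Function.uncurry f))
    (hs : Continuous s) (ht : Continuous t) :
    Continuous fun x => ∫ θ in s x..t x, f x θ := by
  have h (x : X) : ∫ θ in s x..t x, f x θ =
      (∫ θ in (0 : ℝ)..t x, f x θ) - ∫ θ in (0 : ℝ)..s x, f x θ := by
    have hx : Continuous (f x) := by fun_prop
    exact (intervalIntegral.integral_interval_sub_left
      (hx.intervalIntegrable _ _) (hx.intervalIntegrable _ _)).symm
  simp only [h]
  exact (intervalIntegral.continuous_parametric_intervalIntegral_of_continuous hf ht).sub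
    (intervalIntegral.continuous_parametric_intervalIntegral_of_continuous hf hs)

theorem integrable_uncurry_restrict_prod {F : Type*} [NormedAddCommGroup F] {f : ℝ → ℝ → F}
    (hf : Continuous (Function.uncurry f)) (s t p q : ℝ) :
    Integrable (Function.uncurry f)
      ((volume.restrict (uIoc s t)).prod (volume.restrict (uIoc p q))) := by
  rw [Measure.prod_restrict]
  exact (hf.continuousOn.integrableOn_compact (isCompact_uIcc.prod isCompact_uIcc)).mono_set
    (prod_mono uIoc_subset_uIcc uIoc_subset_uIcc)

theorem intervalIntegral_swap_of_continuous {f : ℝ → ℝ → E}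
    (hf : Continuous (Function.uncurry f)) (s t p q : ℝ) :
    ∫ η in s..t, ∫ θ in p..q, f η θ = ∫ θ in p..q, ∫ η in s..t, f η θ := by
  simp only [intervalIntegral.intervalIntegral_eq_integral_uIoc, integral_smul]
  rw [smul_comm, integral_integral_swap (integrable_uncurry_restrict_prod hf s t p q)]

/-- Fubini's theorem on a triangle. -/
theorem intervalIntegral_swap_triangle {f : ℝ → ℝ → E}
    (hf : Continuous (Function.uncurry f)) {s x : ℝ} (hsx : s ≤ x) :
    ∫ η in s..x, ∫ θ in s..η, f η θ = ∫ θ in s..x, ∫ η in θ..x, f η θ := by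
  have hm : MeasurableSet {z : ℝ × ℝ | z.2 < z.1} := measurableSet_lt measurable_snd measurable_fst
  have hint := (integrable_uncurry_restrict_prod hf s x s x).indicator hm
  have hswap := integral_integral_swap
    (f := fun η θ => {z : ℝ × ℝ | z.2 < z.1}.indicator (Function.uncurry f) (η, θ)) hint
  rw [uIoc_of_le hsx] at hswap
  rw [intervalIntegral.integral_of_le hsx, intervalIntegral.integral_of_le hsx]
  convert hswap using 1
  · refine setIntegral_congr_fun measurableSet_Ioc fun η hη => ?_
    have h : (fun θ => {z : ℝ × ℝ | z.2 < z.1}.indicator (Function.uncurry f) (η, θ))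
        = (Iio η).indicator (f η) := by
      ext θ; simp [indicator, Function.uncurry]
    have h' : Ioc s x ∩ Iio η = Ioo s η := by
      ext θ; simp only [mem_inter_iff, mem_Ioc, mem_Iio, mem_Ioo] at hη ⊢; grind
    simp only [h]
    rw [setIntegral_indicator measurableSet_Iio, h', ← integral_Ioc_eq_integral_Ioo,
      intervalIntegral.integral_of_le hη.1.le]
  · refine setIntegral_congr_fun measurableSet_Ioc fun θ hθ => ?_
    have h : (fun η => {z : ℝ × ℝ | z.2 < z.1}.indicator (Function.uncurry f) (η, θ))
        = (Ioi θ).indicator (fun η => f η θ) := by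
      ext η; simp [indicator, Function.uncurry]
    have h' : Ioc s x ∩ Ioi θ = Ioc θ x := by
      ext η; simp only [mem_inter_iff, mem_Ioc, mem_Ioi] at hθ ⊢; grind
    simp only [h]
    rw [setIntegral_indicator measurableSet_Ioi, h', intervalIntegral.integral_of_le hθ.2]

end Integrals

section MatrixIntegrals

variable {p q r : ℕ}

theorem mulVec_intervalIntegral (M : Matrix (Fin p) (Fin r) ℝ) {f : ℝ → Fin r → ℝ}
    (hf : Continuous f) (s t : ℝ) :
    M *ᵥ (∫ θ in s..t, f θ) = ∫ θ in s..t, M *ᵥ f θ :=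
  (M.mulVecLin.toContinuousLinearMap.intervalIntegral_comp_comm
    (hf.intervalIntegrable s t)).symm

theorem mInt_mulVec {F : ℝ → Matrix (Fin p) (Fin r) ℝ} (hF : Continuous F) (s t : ℝ)
    (v : Fin r → ℝ) :
    mInt s t F *ᵥ v = ∫ η in s..t, F η *ᵥ v := by
  ext i
  have hcont : Continuous fun η => F η *ᵥ v := by fun_prop
  have hproj := (ContinuousLinearMap.proj (R := ℝ) (φ := fun _ : Fin p => ℝ)
    i).intervalIntegral_comp_comm (hcont.intervalIntegrable (μ := volume) s t)
  simp only [ContinuousLinearMap.proj_apply] at hproj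
  rw [← hproj]
  simp only [mulVec, dotProduct, mInt, of_apply]
  rw [intervalIntegral.integral_finsetSum]
  · simp only [intervalIntegral.integral_mul_const]
  · intro j _
    have hj : Continuous fun η => F η i j * v j := by fun_prop
    exact hj.intervalIntegrable _ _

@[fun_prop]
theorem Continuous.mInt {X : Type*} [TopologicalSpace X]
    {F : X → ℝ → Matrix (Fin p) (Fin r) ℝ} {s t : X → ℝ} (hF : Continuous (Function.uncurry F))
    (hs : Continuous s) (ht : Continuous t) :
    Continuous fun x => mInt (s x) (t x) (F x) := by
  refine continuous_matrix fun i j => ?_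
  simp only [_root_.mInt, of_apply]
  fun_prop

variable {A : ℝ → Matrix (Fin q) (Fin p) ℝ} {K : ℝ → ℝ → Matrix (Fin p) (Fin r) ℝ}
  {u : ℝ → Fin r → ℝ}

theorem integral_mulVec_integral (hA : Continuous A) (hK : Continuous (Function.uncurry K))
    (hu : Continuous u) (s t s' t' : ℝ) :
    ∫ η in s..t, A η *ᵥ (∫ θ in s'..t', K η θ *ᵥ u θ)
      = ∫ θ in s'..t', mInt s t (fun η => A η * K η θ) *ᵥ u θ := by
  simp (disch := with_unfolding_all fun_prop) only [mulVec_intervalIntegral,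
    mInt_mulVec, mulVec_mulVec]
  exact intervalIntegral_swap_of_continuous (by fun_prop) _ _ _ _

theorem integral_mulVec_integral_lower (hA : Continuous A)
    (hK : Continuous (Function.uncurry K)) (hu : Continuous u) {s x : ℝ} (hsx : s ≤ x) :
    ∫ η in s..x, A η *ᵥ (∫ θ in s..η, K η θ *ᵥ u θ)
      = ∫ θ in s..x, mInt θ x (fun η => A η * K η θ) *ᵥ u θ := by
  simp (disch := with_unfolding_all fun_prop) only [mulVec_intervalIntegral,
    mInt_mulVec, mulVec_mulVec]
  exact intervalIntegral_swap_triangle (by fun_prop) hsx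

theorem integral_mulVec_integral_upper (hA : Continuous A)
    (hK : Continuous (Function.uncurry K)) (hu : Continuous u) {x t : ℝ} (hxt : x ≤ t) :
    ∫ η in x..t, A η *ᵥ (∫ θ in η..t, K η θ *ᵥ u θ)
      = ∫ θ in x..t, mInt x θ (fun η => A η * K η θ) *ᵥ u θ := by
  simp (disch := with_unfolding_all fun_prop) only [mulVec_intervalIntegral,
    mInt_mulVec, mulVec_mulVec]
  exact (intervalIntegral_swap_triangle (f := fun θ η => (A η * K η θ) *ᵥ u θ)
    (by fun_prop) hxt).symm

end MatrixIntegrals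

section OneDimensional

variable {p q r : ℕ}

/-- Continuity of a family of 1D-PI kernels on the whole line. -/
structure PI1DK.IsContinuous (N : PI1DK p r) : Prop where
  k0 : Continuous N.k0
  k1 : Continuous (Function.uncurry N.k1)
  k2 : Continuous (Function.uncurry N.k2)

theorem PI1D_continuous {N : PI1DK p r} (hN : N.IsContinuous) {u : ℝ → Fin r → ℝ}
    (hu : Continuous u) (s t : ℝ) : Continuous (PI1D s t N u) := by
  obtain ⟨h0, h1, h2⟩ := hN
  unfold PI1D
  fun_prop

theorem PI1D_add {N : PI1DK p r} (hN : N.IsContinuous) {f g : ℝ → Fin r → ℝ}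
    (hf : Continuous f) (hg : Continuous g) (s t x : ℝ) :
    PI1D s t N (fun θ => f θ + g θ) x = PI1D s t N f x + PI1D s t N g x := by
  obtain ⟨h0, h1, h2⟩ := hN
  simp (disch := with_unfolding_all fun_prop) only [PI1D, mulVec_add,
    intervalIntegral_add_of_continuous]
  abel

/-- The action of a 1D-PI operator on the columns of a matrix-valued function. -/
def PI1DK.applyMatrix (s t : ℝ) (N : PI1DK q p) (b : ℝ → Matrix (Fin p) (Fin r) ℝ) (x : ℝ) :
    Matrix (Fin q) (Fin r) ℝ :=
  N.k0 x * b x + mInt s x (fun η => N.k1 x η * b η) + mInt x t (fun η => N.k2 x η * b η)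

theorem PI1D_mulVec_const {N : PI1DK q p} (hN : N.IsContinuous)
    {b : ℝ → Matrix (Fin p) (Fin r) ℝ} (hb : Continuous b) (v : Fin r → ℝ) (s t x : ℝ) :
    PI1D s t N (fun θ => b θ *ᵥ v) x = N.applyMatrix s t b x *ᵥ v := by
  obtain ⟨h0, h1, h2⟩ := hN
  simp (disch := with_unfolding_all fun_prop) only [PI1D, PI1DK.applyMatrix, add_mulVec,
    mInt_mulVec, mulVec_mulVec]

theorem PI1D_integral {N : PI1DK q p} (hN : N.IsContinuous)
    {K : ℝ → ℝ → Matrix (Fin p) (Fin r) ℝ} (hK : Continuous (Function.uncurry K))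
    {w : ℝ → Fin r → ℝ} (hw : Continuous w) (s t s' t' x : ℝ) :
    PI1D s t N (fun η => ∫ ν in s'..t', K η ν *ᵥ w ν) x
      = ∫ ν in s'..t', N.applyMatrix s t (fun η => K η ν) x *ᵥ w ν := by
  obtain ⟨h0, h1, h2⟩ := hN
  simp only [PI1D, PI1DK.applyMatrix, add_mulVec]
  rw [intervalIntegral_add_of_continuous (by fun_prop) (by fun_prop),
    intervalIntegral_add_of_continuous (by fun_prop) (by fun_prop),
    integral_mulVec_integral (by fun_prop) hK hw, integral_mulVec_integral (by fun_prop) hK hw,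
    mulVec_intervalIntegral _ (by fun_prop)]
  simp only [mulVec_mulVec]

/-- Addition of a full-range integral kernel to a family of 1D-PI kernels. -/
def PI1DK.addIntegral (N : PI1DK p r) (K : ℝ → ℝ → Matrix (Fin p) (Fin r) ℝ) : PI1DK p r where
  k0 := N.k0
  k1 x θ := N.k1 x θ + K x θ
  k2 x θ := N.k2 x θ + K x θ

theorem PI1D_addIntegral {N : PI1DK p r} (hN : N.IsContinuous)
    {K : ℝ → ℝ → Matrix (Fin p) (Fin r) ℝ} {u : ℝ → Fin r → ℝ} (hu : Continuous u)
    (s t x : ℝ) (hK : Continuous (K x)) :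
    PI1D s t (N.addIntegral K) u x = PI1D s t N u x + ∫ θ in s..t, K x θ *ᵥ u θ := by
  obtain ⟨h0, h1, h2⟩ := hN
  have hc : Continuous fun θ => K x θ *ᵥ u θ := by fun_prop
  simp only [PI1D, PI1DK.addIntegral, add_mulVec]
  rw [intervalIntegral_add_of_continuous (by fun_prop) (by fun_prop),
    intervalIntegral_add_of_continuous (by fun_prop) (by fun_prop),
    intervalIntegral_split_of_continuous hc s x t]
  abel

/-- The kernels of the composition of two 1D-PI operators. -/
def PI1DK.comp (s t : ℝ) (N : PI1DK q p) (M : PI1DK p r) : PI1DK q r where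
  k0 x := N.k0 x * M.k0 x
  k1 x θ := N.k0 x * M.k1 x θ + N.k1 x θ * M.k0 θ
    + mInt s θ (fun η => N.k1 x η * M.k2 η θ)
    + mInt θ x (fun η => N.k1 x η * M.k1 η θ)
    + mInt x t (fun η => N.k2 x η * M.k1 η θ)
  k2 x θ := N.k0 x * M.k2 x θ + N.k2 x θ * M.k0 θ
    + mInt s x (fun η => N.k1 x η * M.k2 η θ)
    + mInt x θ (fun η => N.k2 x η * M.k2 η θ)
    + mInt θ t (fun η => N.k2 x η * M.k1 η θ)

theorem PI1DK.IsContinuous.comp {N : PI1DK q p} {M : PI1DK p r} (hN : N.IsContinuous)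
    (hM : M.IsContinuous) (s t : ℝ) : (N.comp s t M).IsContinuous := by
  obtain ⟨h0, h1, h2⟩ := hN
  obtain ⟨g0, g1, g2⟩ := hM
  constructor <;> simp only [PI1DK.comp, Function.uncurry_def] <;> fun_prop

theorem PI1D_comp {N : PI1DK q p} {M : PI1DK p r} (hN : N.IsContinuous)
    (hM : M.IsContinuous) {u : ℝ → Fin r → ℝ} (hu : Continuous u) {s t x : ℝ}
    (hx : x ∈ Icc s t) :
    PI1D s t N (PI1D s t M u) x = PI1D s t (N.comp s t M) u x := by
  obtain ⟨h0, h1, h2⟩ := hN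
  obtain ⟨g0, g1, g2⟩ := hM
  have hleft : ∫ η in s..x, N.k1 x η *ᵥ PI1D s t M u η =
      (∫ θ in s..x, (N.k1 x θ * M.k0 θ) *ᵥ u θ)
      + (∫ θ in s..x, mInt θ x (fun η => N.k1 x η * M.k1 η θ) *ᵥ u θ)
      + (∫ θ in s..x, mInt s θ (fun η => N.k1 x η * M.k2 η θ) *ᵥ u θ)
      + ∫ θ in x..t, mInt s x (fun η => N.k1 x η * M.k2 η θ) *ᵥ u θ := by
    rw [← integral_mulVec_integral_lower (by fun_prop) g1 hu hx.1,
      ← integral_mulVec_integral_upper (by fun_prop) g2 hu hx.1,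
      ← integral_mulVec_integral (by fun_prop) g2 hu,
      ← intervalIntegral_add_of_continuous (by fun_prop) (by fun_prop),
      ← intervalIntegral_add_of_continuous (by fun_prop) (by fun_prop),
      ← intervalIntegral_add_of_continuous (by fun_prop) (by fun_prop)]
    refine intervalIntegral.integral_congr fun η _ => ?_
    have hc : Continuous fun θ => M.k2 η θ *ᵥ u θ := by fun_prop
    simp only [PI1D, mulVec_add, mulVec_mulVec, add_assoc,
      intervalIntegral_split_of_continuous hc η x t]
  have hright : ∫ η in x..t, N.k2 x η *ᵥ PI1D s t M u η =
      (∫ θ in x..t, (N.k2 x θ * M.k0 θ) *ᵥ u θ)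
      + (∫ θ in s..x, mInt x t (fun η => N.k2 x η * M.k1 η θ) *ᵥ u θ)
      + (∫ θ in x..t, mInt θ t (fun η => N.k2 x η * M.k1 η θ) *ᵥ u θ)
      + ∫ θ in x..t, mInt x θ (fun η => N.k2 x η * M.k2 η θ) *ᵥ u θ := by
    rw [← integral_mulVec_integral_lower (by fun_prop) g1 hu hx.2,
      ← integral_mulVec_integral_upper (by fun_prop) g2 hu hx.2,
      ← integral_mulVec_integral (by fun_prop) g1 hu,
      ← intervalIntegral_add_of_continuous (by fun_prop) (by fun_prop),
      ← intervalIntegral_add_of_continuous (by fun_prop) (by fun_prop),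
      ← intervalIntegral_add_of_continuous (by fun_prop) (by fun_prop)]
    refine intervalIntegral.integral_congr fun η _ => ?_
    have hc : Continuous fun θ => M.k1 η θ *ᵥ u θ := by fun_prop
    simp only [PI1D, mulVec_add, mulVec_mulVec, add_assoc,
      intervalIntegral_split_of_continuous hc s x η]
  have hmid : N.k0 x *ᵥ PI1D s t M u x = (N.k0 x * M.k0 x) *ᵥ u x
      + (∫ θ in s..x, (N.k0 x * M.k1 x θ) *ᵥ u θ)
      + ∫ θ in x..t, (N.k0 x * M.k2 x θ) *ᵥ u θ := by
    simp (disch := with_unfolding_all fun_prop) only [PI1D, mulVec_add,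
      mulVec_intervalIntegral, mulVec_mulVec]
  rw [PI1D, hmid, hleft, hright]
  simp only [PI1D, PI1DK.comp, add_mulVec]
  simp (disch := with_unfolding_all fun_prop) only [intervalIntegral_add_of_continuous]
  abel

end OneDimensional

section Clamp

variable {p r : ℕ}

/-- The retraction of the line onto the interval `[s,t]`. -/
def clamp (s t x : ℝ) : ℝ := max s (min t x)

@[fun_prop]
theorem continuous_clamp (s t : ℝ) : Continuous (clamp s t) := by
  unfold clamp
  fun_prop

theorem clamp_mem {s t : ℝ} (h : s ≤ t) (x : ℝ) : clamp s t x ∈ Icc s t :=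
  ⟨le_max_left _ _, max_le h (min_le_left _ _)⟩

theorem clamp_of_mem {s t x : ℝ} (hx : x ∈ Icc s t) : clamp s t x = x := by
  rw [clamp, min_eq_right hx.2, max_eq_right hx.1]

theorem ContinuousOn.comp_clamp {X : Type*} [TopologicalSpace X] {f : ℝ → X} {s t : ℝ}
    (hf : ContinuousOn f (Icc s t)) (h : s ≤ t) : Continuous fun x => f (clamp s t x) :=
  hf.comp_continuous (by fun_prop) fun _ => clamp_mem h _

theorem ContinuousOn.comp_clamp_prod {X : Type*} [TopologicalSpace X] {f : ℝ → ℝ → X}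
    {s t s' t' : ℝ} (hf : ContinuousOn (fun z : ℝ × ℝ => f z.1 z.2) (Icc s t ×ˢ Icc s' t'))
    (h : s ≤ t) (h' : s' ≤ t') :
    Continuous (Function.uncurry fun x y => f (clamp s t x) (clamp s' t' y)) :=
  hf.comp_continuous (f := fun z : ℝ × ℝ => (clamp s t z.1, clamp s' t' z.2)) (by fun_prop)
    fun _ => ⟨clamp_mem h _, clamp_mem h' _⟩

theorem ContinuousOn.comp_clamp_prod₃ {X : Type*} [TopologicalSpace X] {f : ℝ → ℝ → ℝ → X}
    {s t s' t' s'' t'' : ℝ}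
    (hf : ContinuousOn (fun z : ℝ × ℝ × ℝ => f z.1 z.2.1 z.2.2)
      (Icc s t ×ˢ Icc s' t' ×ˢ Icc s'' t''))
    (h : s ≤ t) (h' : s' ≤ t') (h'' : s'' ≤ t'') :
    Continuous fun z : ℝ × ℝ × ℝ =>
      f (clamp s t z.1) (clamp s' t' z.2.1) (clamp s'' t'' z.2.2) :=
  hf.comp_continuous
    (f := fun z : ℝ × ℝ × ℝ => (clamp s t z.1, clamp s' t' z.2.1, clamp s'' t'' z.2.2))
    (by fun_prop) fun _ => ⟨clamp_mem h _, clamp_mem h' _, clamp_mem h'' _⟩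

theorem integral_mulVec_congr {K K' : ℝ → Matrix (Fin p) (Fin r) ℝ} {u u' : ℝ → Fin r → ℝ}
    {s t : ℝ} (h : s ≤ t) (hK : EqOn K K' (Icc s t)) (hu : EqOn u u' (Icc s t)) :
    ∫ θ in s..t, K θ *ᵥ u θ = ∫ θ in s..t, K' θ *ᵥ u' θ :=
  intervalIntegral.integral_congr fun θ hθ => by
    rw [uIcc_of_le h] at hθ
    simp only [hK hθ, hu hθ]

theorem PI1D_congr {N N' : PI1DK p r} {u u' : ℝ → Fin r → ℝ} {s t x : ℝ}
    (h0 : N.k0 x = N'.k0 x) (h1 : EqOn (N.k1 x) (N'.k1 x) (Icc s t))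
    (h2 : EqOn (N.k2 x) (N'.k2 x) (Icc s t)) (hu : EqOn u u' (Icc s t)) (hx : x ∈ Icc s t) :
    PI1D s t N u x = PI1D s t N' u' x := by
  have hl : Icc s x ⊆ Icc s t := Icc_subset_Icc_right hx.2
  have hr : Icc x t ⊆ Icc s t := Icc_subset_Icc_left hx.1
  rw [PI1D, PI1D, h0, hu hx, integral_mulVec_congr hx.1 (h1.mono hl) (hu.mono hl),
    integral_mulVec_congr hx.2 (h2.mono hr) (hu.mono hr)]

/-- The extension of 1D-PI kernels from `[s,t]` to the line along `clamp`. -/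
def PI1DK.clamp (s t : ℝ) (N : PI1DK p r) : PI1DK p r where
  k0 x := N.k0 (_root_.clamp s t x)
  k1 x θ := N.k1 (_root_.clamp s t x) (_root_.clamp s t θ)
  k2 x θ := N.k2 (_root_.clamp s t x) (_root_.clamp s t θ)

theorem PI1DK.IsCont.clamp {N : PI1DK p r} {s t : ℝ} (hN : N.IsCont s t) (h : s ≤ t) :
    (N.clamp s t).IsContinuous := by
  obtain ⟨h0, h1, h2⟩ := hN
  exact ⟨h0.comp_clamp h, h1.comp_clamp_prod h h, h2.comp_clamp_prod h h⟩

theorem PI1D_clamp (N : PI1DK p r) {u u' : ℝ → Fin r → ℝ} {s t x : ℝ}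
    (hu : EqOn u u' (Icc s t)) (hx : x ∈ Icc s t) :
    PI1D s t (N.clamp s t) u x = PI1D s t N u' x := by
  refine PI1D_congr ?_ (fun θ hθ => ?_) (fun θ hθ => ?_) hu hx
  · simp only [PI1DK.clamp, clamp_of_mem hx]
  · simp only [PI1DK.clamp, clamp_of_mem hx, clamp_of_mem hθ]
  · simp only [PI1DK.clamp, clamp_of_mem hx, clamp_of_mem hθ]

end Clamp

section TwoDimensional

variable {n p0 p1 r0 r1 : ℕ}

/-- Continuity of a family of 011-PI kernels on the whole line. -/
structure PI011K.IsContinuous (B : PI011K p0 p1 r0 r1) : Prop where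
  b01 : Continuous B.b01
  b02 : Continuous B.b02
  b10 : Continuous B.b10
  b20 : Continuous B.b20
  b12 : Continuous (Function.uncurry B.b12)
  b21 : Continuous (Function.uncurry B.b21)
  b11 : B.b11.IsContinuous
  b22 : B.b22.IsContinuous

/-- The extension of 011-PI kernels to the line along `clamp`. -/
def PI011K.clamp (a b c d : ℝ) (B : PI011K p0 p1 r0 r1) : PI011K p0 p1 r0 r1 where
  b00 := B.b00
  b01 θ := B.b01 (_root_.clamp a b θ)
  b02 ν := B.b02 (_root_.clamp c d ν)
  b10 x := B.b10 (_root_.clamp a b x)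
  b20 y := B.b20 (_root_.clamp c d y)
  b12 x ν := B.b12 (_root_.clamp a b x) (_root_.clamp c d ν)
  b21 y θ := B.b21 (_root_.clamp c d y) (_root_.clamp a b θ)
  b11 := B.b11.clamp a b
  b22 := B.b22.clamp c d

theorem PI011K.IsCont.clamp {B : PI011K p0 p1 r0 r1} {a b c d : ℝ}
    (hB : B.IsCont a b c d) (hab : a ≤ b) (hcd : c ≤ d) : (B.clamp a b c d).IsContinuous := by
  obtain ⟨h01, h02, h10, h20, h12, h21, h11, h22⟩ := hB
  exact ⟨h01.comp_clamp hab, h02.comp_clamp hcd, h10.comp_clamp hab, h20.comp_clamp hcd,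
    h12.comp_clamp_prod hab hcd, h21.comp_clamp_prod hcd hab, h11.clamp hab, h22.clamp hcd⟩

theorem PI011_clamp_fst (B : PI011K p0 p1 r0 r1) {a b c d : ℝ} (hab : a ≤ b) (hcd : c ≤ d)
    (v : Fin r0 → ℝ) {u1 u1' u2 u2' : ℝ → Fin r1 → ℝ}
    (h1 : EqOn u1 u1' (Icc a b)) (h2 : EqOn u2 u2' (Icc c d)) :
    (PI011 a b c d (B.clamp a b c d) v u1 u2).1 = (PI011 a b c d B v u1' u2').1 := by
  simp only [PI011, PI011K.clamp]
  rw [integral_mulVec_congr hab (fun θ hθ => by rw [clamp_of_mem hθ]) h1,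
    integral_mulVec_congr hcd (fun θ hθ => by rw [clamp_of_mem hθ]) h2]

theorem PI011_clamp_snd_fst (B : PI011K p0 p1 r0 r1) {a b c d : ℝ} (hcd : c ≤ d)
    (v : Fin r0 → ℝ) {u1 u1' u2 u2' : ℝ → Fin r1 → ℝ}
    (h1 : EqOn u1 u1' (Icc a b)) (h2 : EqOn u2 u2' (Icc c d)) :
    EqOn (PI011 a b c d (B.clamp a b c d) v u1 u2).2.1 (PI011 a b c d B v u1' u2').2.1
      (Icc a b) := by
  intro x hx
  simp only [PI011, PI011K.clamp]
  rw [PI1D_clamp _ h1 hx, clamp_of_mem hx,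
    integral_mulVec_congr hcd (fun θ hθ => by rw [clamp_of_mem hθ]) h2]

theorem PI011_clamp_snd_snd (B : PI011K p0 p1 r0 r1) {a b c d : ℝ} (hab : a ≤ b)
    (v : Fin r0 → ℝ) {u1 u1' u2 u2' : ℝ → Fin r1 → ℝ}
    (h1 : EqOn u1 u1' (Icc a b)) (h2 : EqOn u2 u2' (Icc c d)) :
    EqOn (PI011 a b c d (B.clamp a b c d) v u1 u2).2.2 (PI011 a b c d B v u1' u2').2.2
      (Icc c d) := by
  intro y hy
  simp only [PI011, PI011K.clamp]
  rw [PI1D_clamp _ h2 hy, clamp_of_mem hy,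
    integral_mulVec_congr hab (fun θ hθ => by rw [clamp_of_mem hθ]) h1]

/-- Continuity of a family of (011→2D)-PI kernels on the whole plane. -/
structure PI011to2DK.IsContinuous (E : PI011to2DK n r0 r1) : Prop where
  e0 : Continuous fun z : ℝ × ℝ => E.e0 z.1 z.2
  e10 : Continuous fun z : ℝ × ℝ => E.e10 z.1 z.2
  e11 : Continuous fun z : ℝ × ℝ × ℝ => E.e11 z.1 z.2.1 z.2.2
  e12 : Continuous fun z : ℝ × ℝ × ℝ => E.e12 z.1 z.2.1 z.2.2
  e20 : Continuous fun z : ℝ × ℝ => E.e20 z.1 z.2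
  e21 : Continuous fun z : ℝ × ℝ × ℝ => E.e21 z.1 z.2.1 z.2.2
  e22 : Continuous fun z : ℝ × ℝ × ℝ => E.e22 z.1 z.2.1 z.2.2

theorem PI011to2DK.IsContinuous.isCont {E : PI011to2DK n r0 r1} (hE : E.IsContinuous)
    (a b c d : ℝ) : E.IsCont a b c d :=
  ⟨hE.e0.continuousOn, hE.e10.continuousOn, hE.e11.continuousOn, hE.e12.continuousOn,
    hE.e20.continuousOn, hE.e21.continuousOn, hE.e22.continuousOn⟩

/-- The 1D-PI kernels acting on the first function variable at height `y`. -/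
def PI011to2DK.fstKernels (E : PI011to2DK n r0 r1) (y : ℝ) : PI1DK n r1 where
  k0 x := E.e10 x y
  k1 x := E.e11 x y
  k2 x := E.e12 x y

/-- The 1D-PI kernels acting on the second function variable at abscissa `x`. -/
def PI011to2DK.sndKernels (E : PI011to2DK n r0 r1) (x : ℝ) : PI1DK n r1 where
  k0 y := E.e20 x y
  k1 y := E.e21 x y
  k2 y := E.e22 x y

theorem PI011to2DK.IsContinuous.fstKernels {E : PI011to2DK n r0 r1} (hE : E.IsContinuous)
    (y : ℝ) : (E.fstKernels y).IsContinuous := by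
  obtain ⟨-, h0, h1, h2, -, -, -⟩ := hE
  constructor <;> simp only [PI011to2DK.fstKernels] <;> fun_prop

theorem PI011to2DK.IsContinuous.sndKernels {E : PI011to2DK n r0 r1} (hE : E.IsContinuous)
    (x : ℝ) : (E.sndKernels x).IsContinuous := by
  obtain ⟨-, -, -, -, h0, h1, h2⟩ := hE
  constructor <;> simp only [PI011to2DK.sndKernels] <;> fun_prop

theorem PI011to2D_eq_PI1D (a b c d : ℝ) (E : PI011to2DK n r0 r1) (v : Fin r0 → ℝ)
    (u1 u2 : ℝ → Fin r1 → ℝ) (x y : ℝ) :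
    PI011to2D a b c d E v u1 u2 x y = E.e0 x y *ᵥ v + PI1D a b (E.fstKernels y) u1 x
      + PI1D c d (E.sndKernels x) u2 y := by
  simp only [PI011to2D, PI1D, PI011to2DK.fstKernels, PI011to2DK.sndKernels]
  abel

/-- The extension of (011→2D)-PI kernels to the plane along `clamp`. -/
def PI011to2DK.clamp (a b c d : ℝ) (E : PI011to2DK n r0 r1) : PI011to2DK n r0 r1 where
  e0 x y := E.e0 (_root_.clamp a b x) (_root_.clamp c d y)
  e10 x y := E.e10 (_root_.clamp a b x) (_root_.clamp c d y)
  e11 x y θ := E.e11 (_root_.clamp a b x) (_root_.clamp c d y) (_root_.clamp a b θ)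
  e12 x y θ := E.e12 (_root_.clamp a b x) (_root_.clamp c d y) (_root_.clamp a b θ)
  e20 x y := E.e20 (_root_.clamp a b x) (_root_.clamp c d y)
  e21 x y ν := E.e21 (_root_.clamp a b x) (_root_.clamp c d y) (_root_.clamp c d ν)
  e22 x y ν := E.e22 (_root_.clamp a b x) (_root_.clamp c d y) (_root_.clamp c d ν)

theorem PI011to2DK.IsCont.clamp {E : PI011to2DK n r0 r1} {a b c d : ℝ}
    (hE : E.IsCont a b c d) (hab : a ≤ b) (hcd : c ≤ d) : (E.clamp a b c d).IsContinuous := by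
  obtain ⟨h0, h10, h11, h12, h20, h21, h22⟩ := hE
  exact ⟨h0.comp_clamp_prod hab hcd, h10.comp_clamp_prod hab hcd,
    h11.comp_clamp_prod₃ hab hcd hab, h12.comp_clamp_prod₃ hab hcd hab,
    h20.comp_clamp_prod hab hcd, h21.comp_clamp_prod₃ hab hcd hcd,
    h22.comp_clamp_prod₃ hab hcd hcd⟩

theorem PI011to2D_congr (E : PI011to2DK n r0 r1) {a b c d x y : ℝ} (v : Fin r0 → ℝ)
    {u1 u1' u2 u2' : ℝ → Fin r1 → ℝ} (h1 : EqOn u1 u1' (Icc a b)) (h2 : EqOn u2 u2' (Icc c d))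
    (hx : x ∈ Icc a b) (hy : y ∈ Icc c d) :
    PI011to2D a b c d E v u1 u2 x y = PI011to2D a b c d E v u1' u2' x y := by
  rw [PI011to2D_eq_PI1D, PI011to2D_eq_PI1D,
    PI1D_congr rfl (eqOn_refl _ _) (eqOn_refl _ _) h1 hx,
    PI1D_congr rfl (eqOn_refl _ _) (eqOn_refl _ _) h2 hy]

theorem PI011to2D_clamp (E : PI011to2DK n r0 r1) {a b c d x y : ℝ} (v : Fin r0 → ℝ)
    (u1 u2 : ℝ → Fin r1 → ℝ) (hx : x ∈ Icc a b) (hy : y ∈ Icc c d) :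
    PI011to2D a b c d (E.clamp a b c d) v u1 u2 x y = PI011to2D a b c d E v u1 u2 x y := by
  have h1 : (E.clamp a b c d).fstKernels y = (E.fstKernels y).clamp a b := by
    simp only [PI011to2DK.fstKernels, PI011to2DK.clamp, PI1DK.clamp, clamp_of_mem hy]
  have h2 : (E.clamp a b c d).sndKernels x = (E.sndKernels x).clamp c d := by
    simp only [PI011to2DK.sndKernels, PI011to2DK.clamp, PI1DK.clamp, clamp_of_mem hx]
  rw [PI011to2D_eq_PI1D, PI011to2D_eq_PI1D, h1, h2, PI1D_clamp _ (eqOn_refl _ _) hx,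
    PI1D_clamp _ (eqOn_refl _ _) hy]
  simp only [PI011to2DK.clamp, clamp_of_mem hx, clamp_of_mem hy]

variable {m0 m1 : ℕ}

/-- The kernels acting on the first function variable, at height `y`, in the composition of
a 011-PI operator followed by a (011→2D)-PI operator. -/
def PI011to2DK.compFst (a b c d : ℝ) (E : PI011to2DK n p0 p1) (B : PI011K p0 p1 m0 m1) (y : ℝ) :
    PI1DK n m1 :=
  ((E.fstKernels y).comp a b B.b11).addIntegral fun x θ =>
    E.e0 x y * B.b01 θ + (E.sndKernels x).applyMatrix c d (fun ν => B.b21 ν θ) y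

/-- The kernels acting on the second function variable, at abscissa `x`, in the composition of
a 011-PI operator followed by a (011→2D)-PI operator. -/
def PI011to2DK.compSnd (a b c d : ℝ) (E : PI011to2DK n p0 p1) (B : PI011K p0 p1 m0 m1) (x : ℝ) :
    PI1DK n m1 :=
  ((E.sndKernels x).comp c d B.b22).addIntegral fun y ν =>
    E.e0 x y * B.b02 ν + (E.fstKernels y).applyMatrix a b (fun θ => B.b12 θ ν) x

/-- The kernels of the composition of a 011-PI operator followed by a (011→2D)-PI operator. -/
def PI011to2DK.comp (a b c d : ℝ) (E : PI011to2DK n p0 p1) (B : PI011K p0 p1 m0 m1) :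
    PI011to2DK n m0 m1 where
  e0 x y := E.e0 x y * B.b00 + (E.fstKernels y).applyMatrix a b B.b10 x
    + (E.sndKernels x).applyMatrix c d B.b20 y
  e10 x y := (E.compFst a b c d B y).k0 x
  e11 x y := (E.compFst a b c d B y).k1 x
  e12 x y := (E.compFst a b c d B y).k2 x
  e20 x y := (E.compSnd a b c d B x).k0 y
  e21 x y := (E.compSnd a b c d B x).k1 y
  e22 x y := (E.compSnd a b c d B x).k2 y

theorem PI011to2DK.IsContinuous.comp {E : PI011to2DK n p0 p1} {B : PI011K p0 p1 m0 m1}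
    (hE : E.IsContinuous) (hB : B.IsContinuous) (a b c d : ℝ) :
    (E.comp a b c d B).IsContinuous := by
  obtain ⟨h0, h10, h11, h12, h20, h21, h22⟩ := hE
  obtain ⟨g01, g02, g10, g20, g12, g21, ⟨g110, g111, g112⟩, ⟨g220, g221, g222⟩⟩ := hB
  constructor <;>
    simp only [PI011to2DK.comp, PI011to2DK.compFst, PI011to2DK.compSnd, PI1DK.addIntegral,
      PI1DK.comp, PI1DK.applyMatrix, PI011to2DK.fstKernels, PI011to2DK.sndKernels] <;>
    fun_prop

theorem PI011to2D_comp {E : PI011to2DK n p0 p1} {B : PI011K p0 p1 m0 m1}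
    (hE : E.IsContinuous) (hB : B.IsContinuous) (v : Fin m0 → ℝ) {u1 u2 : ℝ → Fin m1 → ℝ}
    (hu1 : Continuous u1) (hu2 : Continuous u2) {a b c d x y : ℝ}
    (hx : x ∈ Icc a b) (hy : y ∈ Icc c d) :
    PI011to2D a b c d E (PI011 a b c d B v u1 u2).1 (PI011 a b c d B v u1 u2).2.1
        (PI011 a b c d B v u1 u2).2.2 x y
      = PI011to2D a b c d (E.comp a b c d B) v u1 u2 x y := by
  have hF := hE.fstKernels y
  have hS := hE.sndKernels x
  obtain ⟨g01, g02, g10, g20, g12, g21, g11, g22⟩ := hB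
  have hP1 := PI1D_continuous g11 hu1 a b
  have hP2 := PI1D_continuous g22 hu2 c d
  have hcF : Continuous fun ν => (E.fstKernels y).applyMatrix a b (fun θ => B.b12 θ ν) x := by
    obtain ⟨h0, h1, h2⟩ := hF
    simp only [PI1DK.applyMatrix]
    fun_prop
  have hcS : Continuous fun θ => (E.sndKernels x).applyMatrix c d (fun ν => B.b21 ν θ) y := by
    obtain ⟨h0, h1, h2⟩ := hS
    simp only [PI1DK.applyMatrix]
    fun_prop
  have hfst : PI1D a b (E.compFst a b c d B y) u1 x
      = PI1D a b (E.fstKernels y) (PI1D a b B.b11 u1) x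
        + (E.e0 x y *ᵥ ∫ θ in a..b, B.b01 θ *ᵥ u1 θ)
        + PI1D c d (E.sndKernels x) (fun ν => ∫ θ in a..b, B.b21 ν θ *ᵥ u1 θ) y := by
    rw [PI011to2DK.compFst, PI1D_addIntegral (hF.comp g11 a b) hu1 _ _ _ (by fun_prop),
      PI1D_comp hF g11 hu1 hx, PI1D_integral hS g21 hu1,
      mulVec_intervalIntegral _ (by fun_prop), add_assoc,
      ← intervalIntegral_add_of_continuous (by fun_prop) (by fun_prop)]
    simp only [add_mulVec, mulVec_mulVec]
  have hsnd : PI1D c d (E.compSnd a b c d B x) u2 y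
      = PI1D c d (E.sndKernels x) (PI1D c d B.b22 u2) y
        + (E.e0 x y *ᵥ ∫ ν in c..d, B.b02 ν *ᵥ u2 ν)
        + PI1D a b (E.fstKernels y) (fun θ => ∫ ν in c..d, B.b12 θ ν *ᵥ u2 ν) x := by
    rw [PI011to2DK.compSnd, PI1D_addIntegral (hS.comp g22 c d) hu2 _ _ _ (by fun_prop),
      PI1D_comp hS g22 hu2 hy, PI1D_integral hF g12 hu2,
      mulVec_intervalIntegral _ (by fun_prop), add_assoc,
      ← intervalIntegral_add_of_continuous (by fun_prop) (by fun_prop)]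
    simp only [add_mulVec, mulVec_mulVec]
  have hT : PI011to2D a b c d (E.comp a b c d B) v u1 u2 x y
      = (E.comp a b c d B).e0 x y *ᵥ v + PI1D a b (E.compFst a b c d B y) u1 x
        + PI1D c d (E.compSnd a b c d B x) u2 y := PI011to2D_eq_PI1D ..
  rw [hT, hfst, hsnd, PI011to2D_eq_PI1D]
  simp only [PI011, PI011to2DK.comp]
  rw [PI1D_add hF (by fun_prop) (by fun_prop), PI1D_add hF (by fun_prop) (by fun_prop),
    PI1D_add hS (by fun_prop) (by fun_prop), PI1D_add hS (by fun_prop) (by fun_prop),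
    PI1D_mulVec_const hF g10, PI1D_mulVec_const hS g20]
  simp only [mulVec_add, add_mulVec, mulVec_mulVec]
  abel

end TwoDimensional

/-- Composition of a 011-PI operator followed by a (011→2D)-PI operator
is a (011→2D)-PI operator. -/
theorem composition_011to2D_after_011 {n2 p0 p1 m0 m1 : ℕ} (a b c d : ℝ)
    (hab : a < b) (hcd : c < d)
    (E : PI011to2DK n2 p0 p1) (B : PI011K p0 p1 m0 m1)
    (hE : E.IsCont a b c d) (hB : B.IsCont a b c d) :
    ∃ T : PI011to2DK n2 m0 m1, T.IsCont a b c d ∧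
      ∀ (v : Fin m0 → ℝ) (u1 u2 : ℝ → Fin m1 → ℝ),
        ContinuousOn u1 (Icc a b) → ContinuousOn u2 (Icc c d) →
        ∀ x ∈ Icc a b, ∀ y ∈ Icc c d,
          PI011to2D a b c d E (PI011 a b c d B v u1 u2).1
              (PI011 a b c d B v u1 u2).2.1 (PI011 a b c d B v u1 u2).2.2 x y
            = PI011to2D a b c d T v u1 u2 x y := by
  have hE' := hE.clamp hab.le hcd.le
  have hB' := hB.clamp hab.le hcd.le
  refine ⟨(E.clamp a b c d).comp a b c d (B.clamp a b c d), (hE'.comp hB' a b c d).isCont a b c d,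
    fun v u1 u2 hu1 hu2 x hx y hy => ?_⟩
  have h1 : EqOn (fun θ => u1 (clamp a b θ)) u1 (Icc a b) := fun θ hθ => by
    simp only [clamp_of_mem hθ]
  have h2 : EqOn (fun ν => u2 (clamp c d ν)) u2 (Icc c d) := fun ν hν => by
    simp only [clamp_of_mem hν]
  rw [← PI011to2D_congr _ v h1 h2 hx hy,
    ← PI011to2D_comp hE' hB' v (hu1.comp_clamp hab.le) (hu2.comp_clamp hcd.le) hx hy,
    PI011to2D_clamp E _ _ _ hx hy, PI011_clamp_fst B hab.le hcd.le v h1 h2]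
  exact (PI011to2D_congr E _ (PI011_clamp_snd_fst B hcd.le v h1 h2)
    (PI011_clamp_snd_snd B hab.le v h1 h2) hx hy).symm
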